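/- Let r ≥ 1 and let S ⊆ ℤ^r be a finite set such that L_S spans ℝ^r and such that for every hyperplane H generated by L_S one has |φ_H(S)| ≥ r+2. Then there exists a nonzero homogeneous polynomial F of positive degree in the variables (X_I)_{I∈S} with complex coefficients such that: for every a : S → ℂ with F((a(I))_{I∈S}) ≠ 0, every I₀ ∈ S and every t ∈ ℂ, the modified coefficients a' (defined by a'(I₀) = t and a'(I) = a(I) for I ≠ I₀) satisfy that neither Z(p_{a'}) nor (ℂ*)^r \ Z(p_{a'}) contains a coset of a one-dimensional subtorus. -/

import Mathlib

open scoped BigOperators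

noncomputable section

/-- The Laurent monomial `z^I = ∏ i, z i ^ (I i)` with integer exponents. -/
def lmon {r : ℕ} (z : Fin r → ℂ) (I : Fin r → ℤ) : ℂ :=
  ∏ i, z i ^ (I i)

/-- The Laurent polynomial `p_a(z) = Σ_{I ∈ S} a(I) z^I`. -/
def pa {r : ℕ} (S : Finset (Fin r → ℤ)) (a : (Fin r → ℤ) → ℂ) (z : Fin r → ℂ) : ℂ :=
  ∑ I ∈ S, a I * lmon z I

/-- The algebraic torus `(ℂ*)^r`, as a subset of `ℂ^r`. -/
def torus (r : ℕ) : Set (Fin r → ℂ) := {z | ∀ i, z i ≠ 0}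

/-- The zero set `Z(p_a) = {z ∈ (ℂ*)^r : p_a(z) = 0}`. -/
def Zset {r : ℕ} (S : Finset (Fin r → ℤ)) (a : (Fin r → ℤ) → ℂ) : Set (Fin r → ℂ) :=
  {z | (∀ i, z i ≠ 0) ∧ pa S a z = 0}

/-- The coset `C(c,v) = {(c_1 t^{v_1}, …, c_r t^{v_r}) : t ∈ ℂ*}` of a
one-dimensional subtorus (for `c ∈ (ℂ*)^r` and `v ∈ ℤ^r` nonzero). -/
def coset {r : ℕ} (c : Fin r → ℂ) (v : Fin r → ℤ) : Set (Fin r → ℂ) :=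
  {z | ∃ t : ℂ, t ≠ 0 ∧ z = fun i => c i * t ^ (v i)}

/-- The grouped coefficient `Q_{a,v,d}(c) = Σ_{I ∈ S, ⟨I,v⟩ = d} a(I) c^I`. -/
def Qc {r : ℕ} (S : Finset (Fin r → ℤ)) (a : (Fin r → ℤ) → ℂ) (v : Fin r → ℤ)
    (d : ℤ) (c : Fin r → ℂ) : ℂ :=
  ∑ I ∈ S.filter (fun I => (∑ i, I i * v i) = d), a I * lmon c I

/-- The embedding of `ℤ^r` into `ℝ^r`. -/
def toR {r : ℕ} (x : Fin r → ℤ) : Fin r → ℝ := fun i => (x i : ℝ)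

/-- The difference set `L_S = {x - y : x, y ∈ S} ⊆ ℝ^r` of a finite set `S ⊆ ℤ^r`. -/
def LS {r : ℕ} (S : Finset (Fin r → ℤ)) : Set (Fin r → ℝ) :=
  {d | ∃ x ∈ S, ∃ y ∈ S, d = toR x - toR y}

/-- `H` is a hyperplane generated by `L_S`: an `(r-1)`-dimensional linear subspace of `ℝ^r`
spanned by a subset of `L_S`. -/
def IsGenHyperplane {r : ℕ} (S : Finset (Fin r → ℤ)) (H : Submodule ℝ (Fin r → ℝ)) : Prop :=
  Module.finrank ℝ H = r - 1 ∧ ∃ T : Set (Fin r → ℝ), T ⊆ LS S ∧ H = Submodule.span ℝ T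

/-- The number `|φ_H(S)|` of distinct images of the points of `S` under the quotient map
`φ_H : ℝ^r → ℝ^r / H`. -/
def quotImgCard {r : ℕ} (S : Finset (Fin r → ℤ)) (H : Submodule ℝ (Fin r → ℝ)) : ℕ :=
  ((fun x => H.mkQ (toR x)) '' (S : Set (Fin r → ℤ))).ncard

open MvPolynomial in
/-- A nonzero polynomial vanishing on a cone has a nonzero homogeneous component that also
vanishes on it. -/
theorem exists_isHomogeneous_vanishing_of_cone {σ K : Type*} [Field K] [Infinite K]
    {V : Set (σ → K)} (hV : ∀ a ∈ V, ∀ s : K, s • a ∈ V) {F : MvPolynomial σ K} (hF : F ≠ 0)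
    (hFV : ∀ a ∈ V, eval a F = 0) :
    ∃ (n : ℕ) (G : MvPolynomial σ K), G ≠ 0 ∧ G.IsHomogeneous n ∧ ∀ a ∈ V, eval a G = 0 := by
  have hn : ∃ n, homogeneousComponent n F ≠ 0 := by
    by_contra! h
    apply hF
    rw [← sum_homogeneousComponent F]
    exact Finset.sum_eq_zero fun i _ => h i
  obtain ⟨n, hn⟩ := hn
  refine ⟨n, _, hn, homogeneousComponent_isHomogeneous n F, fun a ha => ?_⟩
  have hscale : ∀ (k : ℕ) (s : K), eval (s • a) (homogeneousComponent k F) =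
      s ^ k * eval a (homogeneousComponent k F) := by
    intro k s
    rw [eval_eq, eval_eq, Finset.mul_sum]
    refine Finset.sum_congr rfl fun d hd => ?_
    have hdeg := (homogeneousComponent_isHomogeneous k F) (mem_support_iff.mp hd)
    rw [Finsupp.weight_apply] at hdeg
    simp only [Pi.one_apply, smul_eq_mul, mul_one] at hdeg
    simp only [Pi.smul_apply, smul_eq_mul, mul_pow, Finset.prod_mul_distrib,
      Finset.prod_pow_eq_pow_sum]
    rw [show ∑ i ∈ d.support, d i = k from hdeg]
    ring
  let p : Polynomial K := ∑ k ∈ Finset.range (F.totalDegree + 1),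
    Polynomial.monomial k (eval a (homogeneousComponent k F))
  have hp : p = 0 := by
    refine Polynomial.funext fun s => ?_
    have h := hFV _ (hV a ha s)
    rw [← sum_homogeneousComponent F, map_sum] at h
    simp only [p, Polynomial.eval_finsetSum, Polynomial.eval_monomial, Polynomial.eval_zero]
    rw [← h]
    exact Finset.sum_congr rfl fun k _ => by rw [hscale, mul_comm]
  have hc := congrArg (fun q => Polynomial.coeff q n) hp
  simp only [p, Polynomial.finsetSum_coeff, Polynomial.coeff_monomial, Polynomial.coeff_zero,
    Finset.sum_ite_eq', Finset.mem_range] at hc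
  split_ifs at hc with h
  · exact hc
  · exact absurd (homogeneousComponent_eq_zero n F (by omega)) hn

/-- More polynomials than variables are algebraically dependent. -/
theorem exists_aeval_eq_zero_of_card_lt {σ τ K : Type} [Field K] [Fintype σ] [Fintype τ]
    (h : Fintype.card τ < Fintype.card σ) (P : σ → MvPolynomial τ K) :
    ∃ F : MvPolynomial σ K, F ≠ 0 ∧ MvPolynomial.aeval P F = 0 := by
  by_contra! hc
  have hP : AlgebraicIndependent K P := by
    rw [algebraicIndependent_iff]
    intro p hp
    by_contra hp0
    exact hc p hp0 hp
  have := hP.cardinalMk_le_trdeg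
  rw [MvPolynomial.trdeg_of_isDomain] at this
  simp only [Cardinal.mk_fintype, Cardinal.lift_natCast, Nat.cast_le] at this
  omega

/-- If a linear span is proper, spanning sets of the ambient space can be cut down to a
hyperplane that contains it. -/
theorem exists_span_hyperplane {K V : Type*} [Field K] [AddCommGroup V] [Module K V]
    [FiniteDimensional K V] {D L : Set V} (hDL : D ⊆ L) (hL : Submodule.span K L = ⊤)
    (hD : Submodule.span K D ≠ ⊤) :
    ∃ T ⊆ L, Submodule.span K D ≤ Submodule.span K T ∧
      Module.finrank K (Submodule.span K T) = Module.finrank K V - 1 := by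
  obtain ⟨b, hbD, hbs, hbi⟩ := exists_linearIndependent K D
  obtain ⟨B, hBL, hbB, hLB, hBi⟩ :=
    exists_linearIndepOn_id_extension (s := b) hbi (hbD.trans hDL)
  have hB : Submodule.span K B = ⊤ := by
    rw [eq_top_iff, ← hL]
    exact Submodule.span_le.mpr hLB
  have hne : ∃ x ∈ B, x ∉ b := by
    by_contra! h
    apply hD
    rw [← hbs, hbB.antisymm h, hB]
  obtain ⟨x, hxB, hxb⟩ := hne
  have hfin : B.Finite := LinearIndependent.setFinite hBi
  have hcB : B.ncard = Module.finrank K V := by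
    have := hfin.fintype
    rw [← finrank_top, ← hB, finrank_span_set_eq_card hBi, Set.ncard_eq_toFinset_card']
  refine ⟨B \ {x}, Set.sdiff_subset.trans hBL, ?_, ?_⟩
  · rw [← hbs]
    exact Submodule.span_mono fun y hy => ⟨hbB hy, fun h => hxb (h ▸ hy)⟩
  · have := (hfin.subset (Set.sdiff_subset (t := {x}))).fintype
    rw [finrank_span_set_eq_card (LinearIndepOn.mono hBi Set.sdiff_subset),
      ← Set.ncard_eq_toFinset_card', Set.ncard_sdiff_singleton_of_mem hxB, hcB]

open Polynomial in
/-- A polynomial over an algebraically closed field which has either no nonzero root or all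
nonzero elements as roots is a monomial. -/
theorem exists_coeff_eq_zero_of_roots {K : Type*} [Field K] [IsAlgClosed K]
    (p : K[X]) (hp : (∀ t ≠ 0, p.eval t = 0) ∨ ∀ t ≠ 0, p.eval t ≠ 0) :
    ∃ m, ∀ n ≠ m, p.coeff n = 0 := by
  by_cases h0 : p = 0
  · exact ⟨0, by simp [h0]⟩
  rcases hp with hp | hp
  · exfalso
    have : X * p = 0 := by
      refine Polynomial.funext fun t => ?_
      by_cases ht : t = 0
      · simp [ht]
      · simp [hp t ht]
    simp [h0] at this
  obtain ⟨q, hq, hnd⟩ := exists_eq_pow_rootMultiplicity_mul_and_not_dvd p h0 0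
  rw [C_0, sub_zero] at hq hnd
  have hdeg : q.degree = 0 := by
    by_contra hd
    obtain ⟨t, ht⟩ := IsAlgClosed.exists_root q hd
    by_cases ht0 : t = 0
    · subst ht0
      exact hnd (by simpa using dvd_iff_isRoot.mpr ht)
    · apply hp t ht0
      rw [hq, eval_mul, ht.eq_zero, mul_zero]
  rw [eq_C_of_degree_eq_zero hdeg] at hq
  refine ⟨p.rootMultiplicity 0, fun n hn => ?_⟩
  rw [hq, mul_comm, coeff_C_mul_X_pow, if_neg hn]

/-- Laurent polynomial version of `exists_coeff_eq_zero_of_roots`. -/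
theorem exists_laurent_coeff_eq_zero {K : Type*} [Field K] [IsAlgClosed K]
    (E : Finset ℤ) (q : ℤ → K)
    (h : (∀ t ≠ 0, ∑ d ∈ E, q d * t ^ d = 0) ∨ ∀ t ≠ 0, ∑ d ∈ E, q d * t ^ d ≠ 0) :
    ∃ m, ∀ d ∈ E, d ≠ m → q d = 0 := by
  obtain ⟨N, hN⟩ : ∃ N : ℕ, ∀ d ∈ E, 0 ≤ d + N := by
    refine ⟨∑ d ∈ E, d.natAbs, fun d hd => ?_⟩
    have := Finset.single_le_sum (f := Int.natAbs) (fun _ _ => Nat.zero_le _) hd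
    omega
  let p : Polynomial K := ∑ d ∈ E, Polynomial.monomial (d + N).toNat (q d)
  have hev : ∀ t ≠ 0, p.eval t = t ^ N * ∑ d ∈ E, q d * t ^ d := by
    intro t ht
    simp only [p, Polynomial.eval_finsetSum, Polynomial.eval_monomial, Finset.mul_sum]
    refine Finset.sum_congr rfl fun d hd => ?_
    rw [← zpow_natCast t (d + N).toNat, Int.toNat_of_nonneg (hN d hd), zpow_add₀ ht, zpow_natCast]
    ring
  obtain ⟨m, hm⟩ := exists_coeff_eq_zero_of_roots p <| h.imp
    (fun h t ht => by rw [hev t ht, h t ht, mul_zero])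
    (fun h t ht => by rw [hev t ht]; exact mul_ne_zero (pow_ne_zero _ ht) (h t ht))
  refine ⟨m - N, fun d hd hdm => ?_⟩
  have hd0 := hN d hd
  rw [← hm (d + N).toNat (by omega)]
  simp only [p, Polynomial.finsetSum_coeff, Polynomial.coeff_monomial]
  rw [Finset.sum_eq_single d]
  · simp
  · intro d' hd' hne
    have := hN d' hd'
    rw [if_neg (by omega)]
  · exact fun h => absurd hd h

open MvPolynomial in
/-- Given `r` disjoint groups of monomials (the colouring `f`) with chosen representatives `g`,
the coefficients for which all `r` partial sums vanish at some torus point whose `i`-th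
coordinate is `1` satisfy a polynomial relation. -/
theorem exists_vanishing_of_grouped_sums {r : ℕ} {σ : Type} [Fintype σ] (e : σ → Fin r → ℤ)
    (i : Fin r) (f : σ → Option (Fin r)) (g : Fin r → σ) (hfg : ∀ j, f (g j) = some j) :
    ∃ F : MvPolynomial σ ℂ, F ≠ 0 ∧ ∀ (a : σ → ℂ) (c : Fin r → ℂ), (∀ l, c l ≠ 0) → c i = 1 →
      (∀ j, ∑ I with f I = some j, a I * lmon c (e I) = 0) → eval a F = 0 := by
  classical
  have hg : Function.Injective g := fun j k h => by
    simpa [hfg] using congrArg f h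
  let τ := {I : σ // I ∉ Set.range g} ⊕ {l : Fin r // l ≠ i}
  have hcard : Fintype.card τ < Fintype.card σ := by
    have h1 := Fintype.card_subtype_compl (fun I => I ∈ Set.range g)
    have h2 : Fintype.card {I // I ∈ Set.range g} = r := by
      rw [← Fintype.card_congr (Equiv.ofInjective g hg), Fintype.card_fin]
    have h3 : Fintype.card {l : Fin r // l ≠ i} = r - 1 := by simp
    have h4 := Fintype.card_le_of_injective g hg
    have h5 := i.pos
    simp only [τ, Fintype.card_sum, h3]
    rw [Fintype.card_fin] at h4
    omega
  obtain ⟨N, hN⟩ : ∃ N : ℕ, ∀ I J l, 0 ≤ e J l - e I l + N := by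
    refine ⟨∑ I, ∑ J, ∑ l, (e J l - e I l).natAbs, fun I J l => ?_⟩
    have h1 := Finset.single_le_sum (f := fun l => (e J l - e I l).natAbs)
      (fun _ _ => Nat.zero_le _) (Finset.mem_univ l)
    have h2 := Finset.single_le_sum (f := fun J => ∑ l, (e J l - e I l).natAbs)
      (fun _ _ => Nat.zero_le _) (Finset.mem_univ J)
    have h3 := Finset.single_le_sum (f := fun I => ∑ J, ∑ l, (e J l - e I l).natAbs)
      (fun _ _ => Nat.zero_le _) (Finset.mem_univ I)
    omega
  let y : Fin r → MvPolynomial τ ℂ := fun l => if h : l = i then 1 else X (Sum.inr ⟨l, h⟩)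
  let P : σ → MvPolynomial τ ℂ := fun I =>
    if h : I ∈ Set.range g then
      -∑ J : {I // I ∉ Set.range g}, if f J = f I then
        X (Sum.inl J) * ∏ l, y l ^ (e J l - e I l + N).toNat else 0
    else X (Sum.inl ⟨I, h⟩) * ∏ l, y l ^ N
  obtain ⟨F, hF, hFP⟩ := exists_aeval_eq_zero_of_card_lt hcard P
  refine ⟨F, hF, ?_⟩
  have key : ∀ (a : σ → ℂ) (c : Fin r → ℂ), (∀ l, c l ≠ 0) → c i = 1 →
      (∀ j, ∑ I with f I = some j, a I * lmon c (e I) = 0) →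
      eval (fun I => a I * ∏ l, c l ^ N) F = 0 := by
    intro a c hc hci hac
    let x : τ → ℂ := Sum.elim (fun J => a J) (fun l => c l)
    have hy : ∀ l, eval x (y l) = c l := by
      intro l
      by_cases h : l = i
      · simp [y, h, hci]
      · simp [y, h, x]
    have hP : ∀ I, eval x (P I) = a I * ∏ l, c l ^ N := by
      intro I
      by_cases h : I ∈ Set.range g
      · obtain ⟨j, rfl⟩ := h
        have hL : ∀ J, lmon c (e J) ≠ 0 := fun J =>
          Finset.prod_ne_zero_iff.mpr fun l _ => zpow_ne_zero _ (hc l)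
        have hterm : ∀ J, ∏ l, c l ^ (e J l - e (g j) l + N).toNat =
            lmon c (e J) * (lmon c (e (g j)))⁻¹ * ∏ l, c l ^ N := by
          intro J
          simp only [lmon, ← Finset.prod_inv_distrib, ← Finset.prod_mul_distrib]
          refine Finset.prod_congr rfl fun l _ => ?_
          rw [← zpow_natCast, Int.toNat_of_nonneg (hN _ _ _), zpow_add₀ (hc l), zpow_sub₀ (hc l),
            zpow_natCast, div_eq_mul_inv]
        have hsum : ∑ J : {I // I ∉ Set.range g},
            (if f J = some j then a J * lmon c (e J) else 0) = -(a (g j) * lmon c (e (g j))) := by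
          have h1 := hac j
          rw [Finset.sum_filter, ← Fintype.sum_subtype_add_sum_subtype (fun I => I ∈ Set.range g)]
            at h1
          rw [Finset.sum_eq_single ⟨g j, j, rfl⟩, if_pos (hfg j)] at h1
          · exact eq_neg_of_add_eq_zero_right h1
          · rintro ⟨_, k, rfl⟩ - hne
            rw [if_neg]
            intro hk
            rw [hfg, Option.some_inj] at hk
            exact hne (by simp [hk])
          · simp
        have hPg : P (g j) = -∑ J : {I // I ∉ Set.range g}, if f J = f (g j) then
            X (Sum.inl J) * ∏ l, y l ^ (e J l - e (g j) l + N).toNat else 0 :=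
          dif_pos ⟨j, rfl⟩
        rw [hPg, map_neg, map_sum]
        have : ∀ J : {I // I ∉ Set.range g}, eval x (if f J = f (g j) then
            X (Sum.inl J) * ∏ l, y l ^ (e J l - e (g j) l + N).toNat else 0) =
            (if f J = some j then a J * lmon c (e J) else 0) *
              ((lmon c (e (g j)))⁻¹ * ∏ l, c l ^ N) := by
          intro J
          rw [hfg]
          split_ifs
          · simp only [map_mul, eval_X, map_prod, map_pow, hy, hterm]
            simp only [x, Sum.elim_inl]
            ring
          · simp
        rw [Finset.sum_congr rfl fun J _ => this J, ← Finset.sum_mul, hsum]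
        have := hL (g j)
        field_simp
      · have hPI : P I = X (Sum.inl ⟨I, h⟩) * ∏ l, y l ^ N := dif_neg h
        simp only [hPI, map_mul, eval_X, map_prod, map_pow, hy]
        rfl
    have h := congrArg (eval x) hFP
    rw [map_zero, aeval_def, ← coe_eval₂Hom, ← RingHom.comp_apply] at h
    rw [← h]
    congr 1
    refine MvPolynomial.ringHom_ext (fun z => by simp) fun I => by simp [hP]
  intro a c hc hci hac
  have hM : ∏ l, c l ^ N ≠ 0 := Finset.prod_ne_zero_iff.mpr fun l _ => pow_ne_zero _ (hc l)
  have := key (fun I => a I * (∏ l, c l ^ N)⁻¹) c hc hci fun j => by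
    have := congrArg (· * (∏ l, c l ^ N)⁻¹) (hac j)
    simp only [zero_mul, Finset.sum_mul] at this
    rw [← this]
    exact Finset.sum_congr rfl fun I _ => by ring
  simpa [mul_assoc, inv_mul_cancel₀ hM] using this

/-- The coefficient vectors for which `r` disjoint nonempty groups of monomials all sum to zero at
a common torus point with one coordinate equal to `1`. -/
def degenerateCoeffs {r : ℕ} {σ : Type} [Fintype σ] (e : σ → Fin r → ℤ) : Set (σ → ℂ) :=
  {a | ∃ (i : Fin r) (f : σ → Option (Fin r)) (g : Fin r → σ) (c : Fin r → ℂ),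
    (∀ j, f (g j) = some j) ∧ (∀ l, c l ≠ 0) ∧ c i = 1 ∧
      ∀ j, ∑ I with f I = some j, a I * lmon c (e I) = 0}

open MvPolynomial in
theorem exists_isHomogeneous_vanishing_degenerateCoeffs {r : ℕ} {σ : Type} [Fintype σ]
    (e : σ → Fin r → ℤ) :
    ∃ (n : ℕ) (G : MvPolynomial σ ℂ), G ≠ 0 ∧ G.IsHomogeneous n ∧
      ∀ a ∈ degenerateCoeffs e, eval a G = 0 := by
  classical
  have h : ∀ x : Fin r × (σ → Option (Fin r)) × (Fin r → σ), ∃ F : MvPolynomial σ ℂ, F ≠ 0 ∧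
      ((∀ j, x.2.1 (x.2.2 j) = some j) → ∀ (a : σ → ℂ) (c : Fin r → ℂ), (∀ l, c l ≠ 0) →
        c x.1 = 1 → (∀ j, ∑ I with x.2.1 I = some j, a I * lmon c (e I) = 0) →
          eval a F = 0) := by
    rintro ⟨i, f, g⟩
    by_cases hfg : ∀ j, f (g j) = some j
    · obtain ⟨F, hF, hF'⟩ := exists_vanishing_of_grouped_sums e i f g hfg
      exact ⟨F, hF, fun _ => hF'⟩
    · exact ⟨1, one_ne_zero, fun h => absurd h hfg⟩
  choose F hF hF' using h
  refine exists_isHomogeneous_vanishing_of_cone (V := degenerateCoeffs e) (F := ∏ x, F x)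
    ?_ (Finset.prod_ne_zero_iff.mpr fun x _ => hF x) ?_
  · rintro a ⟨i, f, g, c, hfg, hc, hci, hac⟩ s
    refine ⟨i, f, g, c, hfg, hc, hci, fun j => ?_⟩
    simp only [Pi.smul_apply, smul_eq_mul, mul_assoc]
    rw [← Finset.mul_sum, hac j, mul_zero]
  · rintro a ⟨i, f, g, c, hfg, hc, hci, hac⟩
    rw [map_prod]
    exact Finset.prod_eq_zero (Finset.mem_univ (i, f, g)) (hF' (i, f, g) hfg a c hc hci hac)

theorem lmon_mul_zpow {r : ℕ} (c : Fin r → ℂ) (v I : Fin r → ℤ) {t : ℂ} (ht : t ≠ 0) :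
    lmon (fun i => c i * t ^ v i) I = lmon c I * t ^ (∑ i, I i * v i) := by
  simp only [lmon, mul_zpow, Finset.prod_mul_distrib, ← zpow_mul]
  congr 1
  rw [← Finset.prod_congr rfl fun i _ => by rw [mul_comm]]
  induction (Finset.univ : Finset (Fin r)) using Finset.induction_on with
  | empty => simp
  | insert a s ha ih => rw [Finset.prod_insert ha, Finset.sum_insert ha, zpow_add₀ ht, ih]

theorem Qc_mul_zpow {r : ℕ} (S : Finset (Fin r → ℤ)) (a : (Fin r → ℤ) → ℂ) (c : Fin r → ℂ)
    (v : Fin r → ℤ) (d : ℤ) {t : ℂ} (ht : t ≠ 0) :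
    Qc S a v d (fun i => c i * t ^ v i) = Qc S a v d c * t ^ d := by
  rw [Qc, Qc, Finset.sum_mul]
  refine Finset.sum_congr rfl fun I hI => ?_
  rw [lmon_mul_zpow c v I ht, (Finset.mem_filter.mp hI).2, mul_assoc]

theorem pa_mul_zpow {r : ℕ} (S : Finset (Fin r → ℤ)) (a : (Fin r → ℤ) → ℂ) (c : Fin r → ℂ)
    (v : Fin r → ℤ) {t : ℂ} (ht : t ≠ 0) :
    pa S a (fun i => c i * t ^ v i) =
      ∑ d ∈ S.image (fun I => ∑ i, I i * v i), Qc S a v d c * t ^ d := by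
  have hmaps : ∀ I ∈ S, (fun I : Fin r → ℤ => ∑ i, I i * v i) I ∈
      S.image fun I => ∑ i, I i * v i := fun I hI => Finset.mem_image_of_mem _ hI
  rw [pa, ← Finset.sum_fiberwise_of_maps_to hmaps]
  refine Finset.sum_congr rfl fun d _ => ?_
  rw [← Qc_mul_zpow S a c v d ht, Qc]

theorem Qc_update_of_ne {r : ℕ} (S : Finset (Fin r → ℤ)) (a : (Fin r → ℤ) → ℂ)
    (v : Fin r → ℤ) (c : Fin r → ℂ) (I₀ : Fin r → ℤ) (t : ℂ) {d : ℤ}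
    (hd : d ≠ ∑ i, I₀ i * v i) : Qc S (Function.update a I₀ t) v d c = Qc S a v d c := by
  refine Finset.sum_congr rfl fun I hI => ?_
  rw [Function.update_of_ne]
  rintro rfl
  exact hd (Finset.mem_filter.mp hI).2.symm

/-- A nonzero integral functional takes at least `r + 2` values on `S`. -/
theorem le_card_levels {r : ℕ} (S : Finset (Fin r → ℤ))
    (hspan : Submodule.span ℝ (LS S) = ⊤)
    (hcard : ∀ H : Submodule ℝ (Fin r → ℝ), IsGenHyperplane S H → r + 2 ≤ quotImgCard S H)
    {v : Fin r → ℤ} (hv : v ≠ 0) :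
    r + 2 ≤ (S.image fun I => ∑ i, I i * v i).card := by
  classical
  let D : Set (Fin r → ℝ) := {d | ∃ x ∈ S, ∃ y ∈ S,
    ∑ i, x i * v i = ∑ i, y i * v i ∧ d = toR x - toR y}
  have hD : Submodule.span ℝ D ≠ ⊤ := by
    intro htop
    let φ : (Fin r → ℝ) →ₗ[ℝ] ℝ := ∑ i, (v i : ℝ) • LinearMap.proj i
    have hφ : Submodule.span ℝ D ≤ LinearMap.ker φ := by
      rw [Submodule.span_le]
      rintro _ ⟨x, -, y, -, hxy, rfl⟩
      have : (∑ i, (x i : ℝ) * v i) = ∑ i, (y i : ℝ) * v i := mod_cast hxy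
      simp only [φ, SetLike.mem_coe, LinearMap.mem_ker, LinearMap.sum_apply, LinearMap.smul_apply,
        LinearMap.proj_apply, smul_eq_mul, Pi.sub_apply, toR, mul_sub, Finset.sum_sub_distrib]
      simp only [mul_comm (v _ : ℝ), this, sub_self]
    apply hv
    funext i
    have h : φ (Pi.single i 1) = 0 := LinearMap.mem_ker.mp (hφ (htop ▸ Submodule.mem_top))
    simpa [φ, LinearMap.sum_apply, Pi.single_apply] using h
  obtain ⟨T, hT, hDT, hfr⟩ := exists_span_hyperplane (D := D) (L := LS S)
    (by rintro _ ⟨x, hx, y, hy, -, rfl⟩; exact ⟨x, hx, y, hy, rfl⟩) hspan hD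
  refine (hcard _ ⟨by simpa using hfr, T, hT, rfl⟩).trans ?_
  set H := Submodule.span ℝ T
  have hfac : ∀ x ∈ S, ∀ y ∈ S, ∑ i, x i * v i = ∑ i, y i * v i →
      H.mkQ (toR x) = H.mkQ (toR y) := fun x hx y hy hxy =>
    (Submodule.Quotient.eq H).mpr (hDT (Submodule.subset_span ⟨x, hx, y, hy, hxy, rfl⟩))
  have hrep : ∀ d, ∃ x : Fin r → ℤ, d ∈ (S.image fun I => ∑ i, I i * v i) →
      x ∈ S ∧ ∑ i, x i * v i = d := by
    intro d
    by_cases hd : d ∈ S.image fun I => ∑ i, I i * v i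
    · obtain ⟨x, hx⟩ := Finset.mem_image.mp hd
      exact ⟨x, fun _ => hx⟩
    · exact ⟨0, fun h => absurd h hd⟩
  choose x hx using hrep
  calc quotImgCard S H
      ≤ ((fun d => H.mkQ (toR (x d))) ''
          (S.image fun I => ∑ i, I i * v i : Finset ℤ)).ncard := by
        refine Set.ncard_le_ncard ?_ ((Finset.finite_toSet _).image _)
        rintro _ ⟨y, hy, rfl⟩
        have hm := Finset.mem_image_of_mem (fun I : Fin r → ℤ => ∑ i, I i * v i) hy
        exact ⟨_, hm, hfac _ (hx _ hm).1 _ hy (hx _ hm).2⟩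
    _ ≤ _ := (Set.ncard_image_le (Finset.finite_toSet _)).trans (Set.ncard_coe_finset _).le

/-- If all but two of the grouped coefficients of `a` along `v` vanish at a torus point, then the
coefficient vector is degenerate. -/
theorem mem_degenerateCoeffs {r : ℕ} (S : Finset (Fin r → ℤ)) (a : (Fin r → ℤ) → ℂ)
    {c : Fin r → ℂ} (hc : ∀ i, c i ≠ 0) {v : Fin r → ℤ} (hv : v ≠ 0) (m₁ m₂ : ℤ)
    (hlev : r + 2 ≤ (S.image fun I => ∑ i, I i * v i).card)
    (hQ : ∀ d ∈ S.image (fun I => ∑ i, I i * v i), d ≠ m₁ → d ≠ m₂ → Qc S a v d c = 0) :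
    (fun I : {I // I ∈ S} => a I) ∈ degenerateCoeffs (fun I : {I // I ∈ S} => I.1) := by
  classical
  obtain ⟨i, hi⟩ := Function.ne_iff.mp hv
  obtain ⟨t, ht⟩ : ∃ t : ℂ, t ^ v i = (c i)⁻¹ := by
    rcases Int.natAbs_eq (v i) with h | h
    · obtain ⟨t, ht⟩ := IsAlgClosed.exists_pow_nat_eq (c i)⁻¹ (Int.natAbs_pos.mpr hi)
      exact ⟨t, by rw [h, zpow_natCast, ht]⟩
    · obtain ⟨t, ht⟩ := IsAlgClosed.exists_pow_nat_eq (c i) (Int.natAbs_pos.mpr hi)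
      exact ⟨t, by rw [h, zpow_neg, zpow_natCast, ht]⟩
  have ht0 : t ≠ 0 := by
    rintro rfl
    rw [zero_zpow _ hi] at ht
    exact inv_ne_zero (hc i) ht.symm
  set L := ((S.image fun I => ∑ i, I i * v i).erase m₁).erase m₂ with hLdef
  have hL : Fintype.card (Fin r) ≤ Fintype.card L := by
    have h1 := Finset.pred_card_le_card_erase (s := S.image fun I => ∑ i, I i * v i) (a := m₁)
    have h2 := Finset.pred_card_le_card_erase
      (s := (S.image fun I => ∑ i, I i * v i).erase m₁) (a := m₂)
    rw [Fintype.card_fin, Fintype.card_coe, hLdef]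
    omega
  obtain ⟨ψ⟩ := Function.Embedding.nonempty_of_card_le hL
  have hψ : ∀ j, (ψ j : ℤ) ≠ m₂ ∧ (ψ j : ℤ) ≠ m₁ ∧
      (ψ j : ℤ) ∈ S.image fun I => ∑ i, I i * v i := fun j => by
    simpa only [hLdef, Finset.mem_erase] using (ψ j).2
  have hrep : ∀ j, ∃ I : {I // I ∈ S}, ∑ i, I.1 i * v i = ψ j := fun j => by
    obtain ⟨I, hI, h⟩ := Finset.mem_image.mp (hψ j).2.2
    exact ⟨⟨I, hI⟩, h⟩
  choose g hg using hrep
  let f : {I // I ∈ S} → Option (Fin r) := fun I =>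
    if h : ∃ j, (ψ j : ℤ) = ∑ i, I.1 i * v i then some h.choose else none
  have hf : ∀ I j, f I = some j ↔ ∑ i, I.1 i * v i = ψ j := by
    intro I j
    by_cases h : ∃ j, (ψ j : ℤ) = ∑ i, I.1 i * v i
    · simp only [f, dif_pos h, Option.some_inj]
      constructor
      · rintro rfl
        exact h.choose_spec.symm
      · intro hj
        exact ψ.injective (Subtype.ext (h.choose_spec.trans hj))
    · simp only [f, dif_neg h, reduceCtorEq, false_iff]
      exact fun hj => h ⟨j, hj.symm⟩
  refine ⟨i, f, g, fun l => c l * t ^ v l, fun j => (hf _ _).mpr (hg j),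
    fun l => mul_ne_zero (hc l) (zpow_ne_zero _ ht0), by simp [ht, hc i], fun j => ?_⟩
  have h := Qc_mul_zpow S a c v (ψ j) ht0
  rw [hQ _ (hψ j).2.2 (hψ j).2.1 (hψ j).1, zero_mul, Qc, Finset.sum_filter, ← Finset.sum_coe_sort]
    at h
  simpa only [Finset.sum_filter, hf] using h

/-- If `L_S` spans `ℝ^r` and `|φ_H(S)| ≥ r + 2` for every hyperplane `H` generated by
`L_S`, then there is a nonzero homogeneous polynomial `F` of positive degree in the
variables `(X_I)_{I ∈ S}` such that whenever `F((a(I))_{I ∈ S}) ≠ 0`, for every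
`I₀ ∈ S` and every `t ∈ ℂ`, the coefficients obtained from `a` by replacing `a(I₀)`
with `t` give a Laurent polynomial whose zero set and complement in `(ℂ*)^r` both
contain no coset of a one-dimensional subtorus. -/
theorem exists_homogeneous_poly_detecting_cosets_after_deformation {r : ℕ} (hr : 1 ≤ r)
    (S : Finset (Fin r → ℤ))
    (hspan : Submodule.span ℝ (LS S) = ⊤)
    (hcard : ∀ H : Submodule ℝ (Fin r → ℝ), IsGenHyperplane S H →
      r + 2 ≤ quotImgCard S H) :
    ∃ (n : ℕ) (F : MvPolynomial {I : Fin r → ℤ // I ∈ S} ℂ),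
      0 < n ∧ F ≠ 0 ∧ F.IsHomogeneous n ∧
      ∀ a : (Fin r → ℤ) → ℂ,
        MvPolynomial.eval (fun I : {I : Fin r → ℤ // I ∈ S} => a I.1) F ≠ 0 →
        ∀ I₀ ∈ S, ∀ t : ℂ,
          (¬ ∃ c : Fin r → ℂ, ∃ v : Fin r → ℤ, (∀ i, c i ≠ 0) ∧ v ≠ 0 ∧
              coset c v ⊆ Zset S (Function.update a I₀ t)) ∧
          (¬ ∃ c : Fin r → ℂ, ∃ v : Fin r → ℤ, (∀ i, c i ≠ 0) ∧ v ≠ 0 ∧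
              coset c v ⊆ torus r \ Zset S (Function.update a I₀ t)) := by
  classical
  obtain ⟨n, G, hG, hGn, hGV⟩ :=
    exists_isHomogeneous_vanishing_degenerateCoeffs (fun I : {I : Fin r → ℤ // I ∈ S} => I.1)
  have hlev : ∀ v : Fin r → ℤ, v ≠ 0 → r + 2 ≤ (S.image fun I => ∑ i, I i * v i).card :=
    fun v hv => le_card_levels S hspan hcard hv
  obtain ⟨J, hJ⟩ : S.Nonempty := by
    have hone : (1 : Fin r → ℤ) ≠ 0 := Function.ne_iff.mpr ⟨⟨0, hr⟩, one_ne_zero⟩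
    have := hlev 1 hone
    exact Finset.image_nonempty.mp (Finset.card_pos.mp ((Nat.succ_pos _).trans_le this))
  refine ⟨n + 1, G * MvPolynomial.X ⟨J, hJ⟩, n.succ_pos, mul_ne_zero hG (MvPolynomial.X_ne_zero _),
    hGn.mul (MvPolynomial.isHomogeneous_X _ _), fun a ha I₀ _ t => ?_⟩
  rw [map_mul] at ha
  have hbad : ∀ (c : Fin r → ℂ) (v : Fin r → ℤ), (∀ i, c i ≠ 0) → v ≠ 0 →
      ¬((∀ s ≠ 0, pa S (Function.update a I₀ t) (fun i => c i * s ^ v i) = 0) ∨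
        ∀ s ≠ 0, pa S (Function.update a I₀ t) (fun i => c i * s ^ v i) ≠ 0) := by
    intro c v hc hv h
    obtain ⟨m, hm⟩ := exists_laurent_coeff_eq_zero (S.image fun I => ∑ i, I i * v i)
      (fun d => Qc S (Function.update a I₀ t) v d c) <| h.imp
      (fun h s hs => by rw [← pa_mul_zpow S _ c v hs]; exact h s hs)
      (fun h s hs => by rw [← pa_mul_zpow S _ c v hs]; exact h s hs)
    refine left_ne_zero_of_mul ha (hGV _ (mem_degenerateCoeffs S a hc hv m (∑ i, I₀ i * v i)
      (hlev v hv) fun d hd hdm hd₀ => ?_))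
    rw [← Qc_update_of_ne S a v c I₀ t hd₀]
    exact hm d hd hdm
  constructor
  · rintro ⟨c, v, hc, hv, hsub⟩
    exact hbad c v hc hv (Or.inl fun s hs => (hsub ⟨s, hs, rfl⟩).2)
  · rintro ⟨c, v, hc, hv, hsub⟩
    refine hbad c v hc hv (Or.inr fun s hs h0 => ?_)
    obtain ⟨h1, h2⟩ := hsub ⟨s, hs, rfl⟩
    exact h2 ⟨h1, h0⟩
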